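/- Let d ≥ 3, 2 < γ < d, and define f(x) = ∫_0^1 (4πs)^{-d/2} exp(-|x|²/(4s)) ds and f_γ(y) = ∫_{ℝ^d} f(y-x)|x|^{-γ} dx. Then there exists C > 0 such that f_γ(y) ≤ C |y|^{-(γ-2)} for all y ≠ 0. -/

import Mathlib

open MeasureTheory

noncomputable def heatKernel (d : ℕ) (t : ℝ) (x : EuclideanSpace ℝ (Fin d)) : ℝ :=
  (4 * Real.pi * t) ^ (-(d : ℝ) / 2) * Real.exp (-‖x‖ ^ 2 / (4 * t))

noncomputable def fOcc (d : ℕ) (x : EuclideanSpace ℝ (Fin d)) : ℝ :=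
  ∫ s in (0 : ℝ)..1, heatKernel d s x

noncomputable def fGamma (d : ℕ) (γ : ℝ) (y : EuclideanSpace ℝ (Fin d)) : ℝ :=
  ∫ x : EuclideanSpace ℝ (Fin d), fOcc d (y - x) * ‖x‖ ^ (-γ)

section Radial

open Set Module

variable {E : Type*} [NormedAddCommGroup E] [NormedSpace ℝ E] [FiniteDimensional ℝ E] [Nontrivial E]

lemma eqOn_pow_finrank_sub_one_smul_indicator (s : Set ℝ) (p : ℝ) :
    EqOn (fun t : ℝ ↦ t ^ (finrank ℝ E - 1) • s.indicator (fun u : ℝ ↦ u ^ (-p)) t)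
      (s.indicator fun u : ℝ ↦ u ^ ((finrank ℝ E : ℝ) - 1 - p)) (Ioi 0) := by
  intro t (ht : 0 < t)
  dsimp only
  have h1 : 1 ≤ finrank ℝ E := finrank_pos
  by_cases h : t ∈ s
  · rw [indicator_of_mem h, indicator_of_mem h, smul_eq_mul, ← Real.rpow_natCast,
      ← Real.rpow_add ht]
    push_cast [h1]
    ring_nf
  · simp [h]

variable [MeasurableSpace E] [BorelSpace E] (μ : Measure E) [μ.IsAddHaarMeasure]

/-- A power `‖x‖ ^ (-p)` with `p < dim E` is integrable near the origin. -/
lemma exists_integral_indicator_Iic_norm_rpow {p : ℝ} (hp : p < finrank ℝ E) :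
    ∃ c : ℝ, 0 ≤ c ∧ ∀ ρ : ℝ, 0 < ρ →
      Integrable (fun x : E ↦ (Iic ρ).indicator (fun u : ℝ ↦ u ^ (-p)) ‖x‖) μ ∧
      ∫ x : E, (Iic ρ).indicator (fun u : ℝ ↦ u ^ (-p)) ‖x‖ ∂μ =
        c * ρ ^ ((finrank ℝ E : ℝ) - p) := by
  refine ⟨finrank ℝ E * μ.real (Metric.ball 0 1) * ((finrank ℝ E : ℝ) - p)⁻¹,
    mul_nonneg (by positivity) (inv_nonneg.2 (by linarith)), fun ρ hρ ↦ ⟨?_, ?_⟩⟩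
  · rw [integrable_fun_norm_addHaar μ (f := (Iic ρ).indicator (fun u : ℝ ↦ u ^ (-p))),
      integrableOn_congr_fun (eqOn_pow_finrank_sub_one_smul_indicator (E := E) _ p)
        measurableSet_Ioi, IntegrableOn, integrable_indicator_iff measurableSet_Iic, IntegrableOn,
      Measure.restrict_restrict measurableSet_Iic, inter_comm, Ioi_inter_Iic, ← IntegrableOn,
      ← intervalIntegrable_iff_integrableOn_Ioc_of_le hρ.le]
    exact intervalIntegral.intervalIntegrable_rpow' (by linarith)
  · rw [integral_fun_norm_addHaar μ ((Iic ρ).indicator (fun u : ℝ ↦ u ^ (-p))),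
      setIntegral_congr_fun measurableSet_Ioi
        (eqOn_pow_finrank_sub_one_smul_indicator (E := E) _ p),
      setIntegral_indicator measurableSet_Iic, Ioi_inter_Iic,
      ← intervalIntegral.integral_of_le hρ.le, integral_rpow (Or.inl (by linarith)),
      show (finrank ℝ E : ℝ) - 1 - p + 1 = finrank ℝ E - p by ring,
      Real.zero_rpow (by linarith), nsmul_eq_mul, smul_eq_mul]
    ring

/-- A power `‖x‖ ^ (-p)` with `dim E < p` is integrable away from the origin. -/
lemma exists_integral_indicator_Ioi_norm_rpow {p : ℝ} (hp : finrank ℝ E < p) :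
    ∃ c : ℝ, 0 ≤ c ∧ ∀ ρ : ℝ, 0 < ρ →
      Integrable (fun x : E ↦ (Ioi ρ).indicator (fun u : ℝ ↦ u ^ (-p)) ‖x‖) μ ∧
      ∫ x : E, (Ioi ρ).indicator (fun u : ℝ ↦ u ^ (-p)) ‖x‖ ∂μ =
        c * ρ ^ ((finrank ℝ E : ℝ) - p) := by
  refine ⟨finrank ℝ E * μ.real (Metric.ball 0 1) * (p - finrank ℝ E)⁻¹,
    mul_nonneg (by positivity) (inv_nonneg.2 (by linarith)), fun ρ hρ ↦ ⟨?_, ?_⟩⟩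
  · rw [integrable_fun_norm_addHaar μ (f := (Ioi ρ).indicator (fun u : ℝ ↦ u ^ (-p))),
      integrableOn_congr_fun (eqOn_pow_finrank_sub_one_smul_indicator (E := E) _ p)
        measurableSet_Ioi, IntegrableOn, integrable_indicator_iff measurableSet_Ioi, IntegrableOn,
      Measure.restrict_restrict measurableSet_Ioi, inter_eq_left.2 (Ioi_subset_Ioi hρ.le),
      ← IntegrableOn]
    exact integrableOn_Ioi_rpow_of_lt (by linarith) hρ
  · rw [integral_fun_norm_addHaar μ ((Ioi ρ).indicator (fun u : ℝ ↦ u ^ (-p))),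
      setIntegral_congr_fun measurableSet_Ioi
        (eqOn_pow_finrank_sub_one_smul_indicator (E := E) _ p),
      setIntegral_indicator measurableSet_Ioi, inter_eq_right.2 (Ioi_subset_Ioi hρ.le),
      integral_Ioi_rpow_of_lt (by linarith) hρ,
      show (finrank ℝ E : ℝ) - 1 - p + 1 = -(p - finrank ℝ E) by ring,
      neg_div_neg_eq, neg_sub, nsmul_eq_mul, smul_eq_mul]
    ring

/-- Pointwise domination of the integrand of the Riesz-type convolution
`∫ ‖y - x‖ ^ (-a) * ‖x‖ ^ (-b)` by three radial functions. -/
lemma norm_sub_rpow_mul_norm_rpow_le {F : Type*} [NormedAddCommGroup F] {a b : ℝ} (ha : 0 ≤ a)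
    (hb : 0 ≤ b) {x y : F} (hy : y ≠ 0) :
    ‖y - x‖ ^ (-a) * ‖x‖ ^ (-b) ≤
      (‖y‖ / 2) ^ (-a) * (Iic (‖y‖ / 2)).indicator (fun u : ℝ ↦ u ^ (-b)) ‖x‖ +
      (‖y‖ / 2) ^ (-b) * (Iic (‖y‖ / 2)).indicator (fun u : ℝ ↦ u ^ (-a)) ‖y - x‖ +
      3 ^ a * (Ioi (‖y‖ / 2)).indicator (fun u : ℝ ↦ u ^ (-(a + b))) ‖x‖ := by
  have hy0 : 0 < ‖y‖ := norm_pos_iff.2 hy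
  have htri : ‖y‖ ≤ ‖y - x‖ + ‖x‖ := by simpa using norm_add_le (y - x) x
  have htri' : ‖x‖ ≤ ‖y‖ + ‖y - x‖ := by
    simpa using norm_sub_le y (y - x)
  have hnn (s : Set ℝ) (p : ℝ) (z : F) : 0 ≤ s.indicator (fun u : ℝ ↦ u ^ (-p)) ‖z‖ := by
    by_cases h : ‖z‖ ∈ s <;> simp only [h, indicator_of_mem, indicator_of_notMem,
      not_false_eq_true, le_refl]
    positivity
  have h1 := hnn (Iic (‖y‖ / 2)) b x
  have h2 := hnn (Iic (‖y‖ / 2)) a (y - x)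
  have h3 := hnn (Ioi (‖y‖ / 2)) (a + b) x
  rcases le_or_gt ‖x‖ (‖y‖ / 2) with hx | hx
  · have : ‖y - x‖ ^ (-a) * ‖x‖ ^ (-b) ≤
        (‖y‖ / 2) ^ (-a) * (Iic (‖y‖ / 2)).indicator (fun u : ℝ ↦ u ^ (-b)) ‖x‖ := by
      rw [indicator_of_mem (mem_Iic.2 hx)]
      refine mul_le_mul_of_nonneg_right ?_ (by positivity)
      exact Real.rpow_le_rpow_of_nonpos (by positivity) (by linarith) (by linarith)
    have : 0 ≤ (‖y‖ / 2) ^ (-b) *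
      (Iic (‖y‖ / 2)).indicator (fun u : ℝ ↦ u ^ (-a)) ‖y - x‖ := by positivity
    have : 0 ≤ (3 : ℝ) ^ a *
      (Ioi (‖y‖ / 2)).indicator (fun u : ℝ ↦ u ^ (-(a + b))) ‖x‖ := by positivity
    linarith
  have hx0 : 0 < ‖x‖ := by linarith
  have h1' : 0 ≤ (‖y‖ / 2) ^ (-a) *
    (Iic (‖y‖ / 2)).indicator (fun u : ℝ ↦ u ^ (-b)) ‖x‖ := by positivity
  rcases le_or_gt ‖y - x‖ (‖y‖ / 2) with hxy | hxy
  · have : ‖y - x‖ ^ (-a) * ‖x‖ ^ (-b) ≤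
        (‖y‖ / 2) ^ (-b) * (Iic (‖y‖ / 2)).indicator (fun u : ℝ ↦ u ^ (-a)) ‖y - x‖ := by
      rw [indicator_of_mem (mem_Iic.2 hxy), mul_comm]
      refine mul_le_mul_of_nonneg_right ?_ (by positivity)
      exact Real.rpow_le_rpow_of_nonpos (by positivity) (by linarith) (by linarith)
    have : 0 ≤ (3 : ℝ) ^ a *
      (Ioi (‖y‖ / 2)).indicator (fun u : ℝ ↦ u ^ (-(a + b))) ‖x‖ := by positivity
    linarith
  · have : ‖y - x‖ ^ (-a) * ‖x‖ ^ (-b) ≤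
        3 ^ a * (Ioi (‖y‖ / 2)).indicator (fun u : ℝ ↦ u ^ (-(a + b))) ‖x‖ := by
      rw [indicator_of_mem (mem_Ioi.2 hx), neg_add, Real.rpow_add hx0, ← mul_assoc]
      refine mul_le_mul_of_nonneg_right ?_ (by positivity)
      calc ‖y - x‖ ^ (-a) ≤ (‖x‖ / 3) ^ (-a) :=
            Real.rpow_le_rpow_of_nonpos (by positivity) (by linarith) (by linarith)
        _ = 3 ^ a * ‖x‖ ^ (-a) := by
            rw [Real.div_rpow hx0.le (by norm_num), Real.rpow_neg (by norm_num : (0 : ℝ) ≤ 3)]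
            simp [mul_comm]
    have : 0 ≤ (‖y‖ / 2) ^ (-b) *
      (Iic (‖y‖ / 2)).indicator (fun u : ℝ ↦ u ^ (-a)) ‖y - x‖ := by positivity
    linarith

/-- The Riesz-type convolution of `‖x‖ ^ (-a)` and `‖x‖ ^ (-b)` is dominated by an integrable
function whose integral has the homogeneity degree `dim E - a - b`. -/
lemma exists_integrable_norm_rpow_convolution_le {a b : ℝ} (ha : 0 ≤ a) (hb : 0 ≤ b)
    (ha' : a < finrank ℝ E) (hb' : b < finrank ℝ E) (hab : finrank ℝ E < a + b) :
    ∃ c : ℝ, 0 ≤ c ∧ ∀ y : E, y ≠ 0 → ∃ g : E → ℝ, Integrable g μ ∧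
      (∀ x, ‖y - x‖ ^ (-a) * ‖x‖ ^ (-b) ≤ g x) ∧
      ∫ x, g x ∂μ = c * ‖y‖ ^ ((finrank ℝ E : ℝ) - (a + b)) := by
  obtain ⟨c₁, hc₁, h₁⟩ := exists_integral_indicator_Iic_norm_rpow μ hb'
  obtain ⟨c₂, hc₂, h₂⟩ := exists_integral_indicator_Iic_norm_rpow μ ha'
  obtain ⟨c₃, hc₃, h₃⟩ := exists_integral_indicator_Ioi_norm_rpow μ hab
  refine ⟨(c₁ + c₂ + 3 ^ a * c₃) * 2⁻¹ ^ ((finrank ℝ E : ℝ) - (a + b)), by positivity,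
    fun y hy ↦ ?_⟩
  have hy0 : 0 < ‖y‖ := norm_pos_iff.2 hy
  have hρ : 0 < ‖y‖ / 2 := by positivity
  obtain ⟨i₁, e₁⟩ := h₁ _ hρ
  obtain ⟨i₂, e₂⟩ := h₂ _ hρ
  obtain ⟨i₃, e₃⟩ := h₃ _ hρ
  replace i₂ := i₂.comp_sub_left y
  rw [← integral_sub_left_eq_self _ μ y] at e₂
  replace i₁ := i₁.const_mul ((‖y‖ / 2) ^ (-a))
  replace i₂ := i₂.const_mul ((‖y‖ / 2) ^ (-b))
  replace i₃ := i₃.const_mul (3 ^ a)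
  refine ⟨_, (i₁.add i₂).add i₃, fun x ↦ norm_sub_rpow_mul_norm_rpow_le ha hb hy, ?_⟩
  rw [integral_add' (i₁.add i₂) i₃, integral_add' i₁ i₂, integral_const_mul, integral_const_mul,
    integral_const_mul, e₁, e₂, e₃]
  have k₁ : (‖y‖ / 2) ^ (-a) * (‖y‖ / 2) ^ ((finrank ℝ E : ℝ) - b) =
      (‖y‖ / 2) ^ ((finrank ℝ E : ℝ) - (a + b)) := by rw [← Real.rpow_add hρ]; ring_nf
  have k₂ : (‖y‖ / 2) ^ (-b) * (‖y‖ / 2) ^ ((finrank ℝ E : ℝ) - a) =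
      (‖y‖ / 2) ^ ((finrank ℝ E : ℝ) - (a + b)) := by rw [← Real.rpow_add hρ]; ring_nf
  have k₃ : (‖y‖ / 2) ^ ((finrank ℝ E : ℝ) - (a + b)) =
      2⁻¹ ^ ((finrank ℝ E : ℝ) - (a + b)) * ‖y‖ ^ ((finrank ℝ E : ℝ) - (a + b)) := by
    rw [← Real.mul_rpow (by norm_num) hy0.le]; ring_nf
  rw [mul_left_comm, k₁, mul_left_comm, k₂, k₃]
  ring

end Radial

section HeatKernel

open Set Nat

variable {d : ℕ}

lemma heatKernel_nonneg {t : ℝ} (ht : 0 ≤ t) (x : EuclideanSpace ℝ (Fin d)) :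
    0 ≤ heatKernel d t x := by
  unfold heatKernel
  positivity

lemma fOcc_nonneg (x : EuclideanSpace ℝ (Fin d)) : 0 ≤ fOcc d x :=
  intervalIntegral.integral_nonneg zero_le_one fun _ hs ↦ heatKernel_nonneg hs.1 x

lemma four_pi_mul_rpow_le {t : ℝ} (ht : 0 < t) :
    (4 * Real.pi * t) ^ (-(d : ℝ) / 2) ≤ t ^ (-(d : ℝ) / 2) := by
  refine Real.rpow_le_rpow_of_nonpos ht ?_ ?_
  · nlinarith [Real.pi_gt_three]
  · have : (0 : ℝ) ≤ d := by positivity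
    linarith

lemma heatKernel_le_rpow {t : ℝ} (ht : 0 < t) (x : EuclideanSpace ℝ (Fin d)) :
    heatKernel d t x ≤ t ^ (-(d : ℝ) / 2) := by
  have hexp : Real.exp (-‖x‖ ^ 2 / (4 * t)) ≤ 1 := by
    rw [Real.exp_le_one_iff, neg_div, neg_nonpos]
    positivity
  calc heatKernel d t x ≤ t ^ (-(d : ℝ) / 2) * 1 :=
        mul_le_mul (four_pi_mul_rpow_le ht) hexp (by positivity) (by positivity)
    _ = _ := mul_one _

/-- For times at most `‖x‖ ^ 2` the heat kernel at `x` is bounded by a multiple of `‖x‖ ^ (-d)`. -/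
lemma heatKernel_le_of_le_norm_sq {t : ℝ} (ht : 0 < t) {x : EuclideanSpace ℝ (Fin d)}
    (htx : t ≤ ‖x‖ ^ 2) :
    heatKernel d t x ≤ d ! * 4 ^ d * (‖x‖ ^ 2) ^ (-(d : ℝ) / 2) := by
  set R := ‖x‖ ^ 2 with hR
  have hR0 : 0 < R := ht.trans_le htx
  have hexp : Real.exp (-R / (4 * t)) ≤ d ! * 4 ^ d * (t / R) ^ d := by
    have h := Real.pow_div_factorial_le_exp (x := R / (4 * t)) (by positivity) d
    rw [neg_div, Real.exp_neg]
    calc (Real.exp (R / (4 * t)))⁻¹ ≤ ((R / (4 * t)) ^ d / d !)⁻¹ :=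
          inv_anti₀ (by positivity) h
      _ = d ! * 4 ^ d * (t / R) ^ d := by
          rw [inv_div, mul_assoc, ← mul_pow, div_eq_mul_inv, ← inv_pow, inv_div]
          ring
  have hpow : (t / R) ^ d ≤ (t / R) ^ ((d : ℝ) / 2) := by
    rw [← Real.rpow_natCast]
    refine Real.rpow_le_rpow_of_exponent_ge (by positivity) ((div_le_one hR0).2 htx) ?_
    have : (0 : ℝ) ≤ d := by positivity
    linarith
  calc heatKernel d t x
      ≤ t ^ (-(d : ℝ) / 2) * (d ! * 4 ^ d * (t / R) ^ ((d : ℝ) / 2)) := by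
        refine mul_le_mul (four_pi_mul_rpow_le ht) (hexp.trans ?_) (by positivity) (by positivity)
        gcongr
    _ = d ! * 4 ^ d * R ^ (-(d : ℝ) / 2) := by
        rw [Real.div_rpow ht.le hR0.le, neg_div, Real.rpow_neg ht.le, Real.rpow_neg hR0.le]
        have : 0 < t ^ ((d : ℝ) / 2) := by positivity
        field_simp

/-- The occupation density is dominated by a multiple of the Newtonian potential. -/
lemma exists_fOcc_le_norm_rpow (hd : 3 ≤ d) :
    ∃ K : ℝ, 0 < K ∧ ∀ x : EuclideanSpace ℝ (Fin d), x ≠ 0 →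
      fOcc d x ≤ K * ‖x‖ ^ (-((d : ℝ) - 2)) := by
  have hd' : (3 : ℝ) ≤ d := by exact_mod_cast hd
  have hd2 : 0 < (d : ℝ) / 2 - 1 := by linarith
  refine ⟨d ! * 4 ^ d + ((d : ℝ) / 2 - 1)⁻¹, by positivity, fun x hx ↦ ?_⟩
  have hx0 : 0 < ‖x‖ := norm_pos_iff.2 hx
  set R := ‖x‖ ^ 2 with hR
  have hR0 : 0 < R := by positivity
  set M : ℝ := d ! * 4 ^ d * R ^ (-(d : ℝ) / 2) with hM
  have hM0 : 0 ≤ M := by positivity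
  set g₁ : ℝ → ℝ := (Ioc 0 R).indicator fun _ ↦ M with hg₁
  set g₂ : ℝ → ℝ := (Ioi R).indicator fun s ↦ s ^ (-(d : ℝ) / 2) with hg₂
  have i₁ : Integrable g₁ := by
    rw [hg₁, integrable_indicator_iff measurableSet_Ioc]
    exact integrableOn_const (by simp)
  have i₂ : Integrable g₂ := by
    rw [hg₂, integrable_indicator_iff measurableSet_Ioi]
    exact integrableOn_Ioi_rpow_of_lt (by linarith) hR0
  have n₁ (s : ℝ) : 0 ≤ g₁ s := indicator_nonneg (fun _ _ ↦ hM0) s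
  have n₂ (s : ℝ) : 0 ≤ g₂ s :=
    indicator_nonneg (fun t ht ↦ Real.rpow_nonneg (hR0.trans ht).le _) s
  have e₁ : ∫ s, g₁ s = R * M := by
    rw [hg₁, integral_indicator measurableSet_Ioc]
    simp [hR0.le]
  have e₂ : ∫ s, g₂ s = ((d : ℝ) / 2 - 1)⁻¹ * R ^ (1 - (d : ℝ) / 2) := by
    rw [hg₂, integral_indicator measurableSet_Ioi, integral_Ioi_rpow_of_lt (by linarith) hR0,
      show -(d : ℝ) / 2 + 1 = -((d : ℝ) / 2 - 1) by ring, neg_div_neg_eq, neg_sub]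
    ring
  have hRM : R * M = d ! * 4 ^ d * R ^ (1 - (d : ℝ) / 2) := by
    rw [hM, mul_left_comm, sub_eq_add_neg, Real.rpow_add hR0, Real.rpow_one, neg_div]
  have hRx : R ^ (1 - (d : ℝ) / 2) = ‖x‖ ^ (-((d : ℝ) - 2)) := by
    rw [hR, ← Real.rpow_natCast, ← Real.rpow_mul hx0.le]
    push_cast
    ring_nf
  calc fOcc d x = ∫ s in Ioc (0 : ℝ) 1, heatKernel d s x := by
        rw [fOcc, intervalIntegral.integral_of_le zero_le_one]
    _ ≤ ∫ s in Ioc (0 : ℝ) 1, (g₁ + g₂) s := by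
        refine integral_mono_of_nonneg ?_ (i₁.add i₂).integrableOn ?_
        · filter_upwards [ae_restrict_mem measurableSet_Ioc] with s hs
          exact heatKernel_nonneg hs.1.le x
        · filter_upwards [ae_restrict_mem measurableSet_Ioc] with s hs
          rcases le_or_gt s R with h | h
          · refine (heatKernel_le_of_le_norm_sq hs.1 h).trans ?_
            have : g₁ s = M := indicator_of_mem (mem_Ioc.2 ⟨hs.1, h⟩) _
            rw [Pi.add_apply, this]
            exact le_add_of_nonneg_right (n₂ s)
          · refine (heatKernel_le_rpow hs.1 x).trans ?_
            have : g₂ s = s ^ (-(d : ℝ) / 2) := indicator_of_mem (mem_Ioi.2 h) _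
            rw [Pi.add_apply, this]
            exact le_add_of_nonneg_left (n₁ s)
    _ ≤ ∫ s, (g₁ + g₂) s :=
        setIntegral_le_integral (i₁.add i₂) (ae_of_all _ fun s ↦ add_nonneg (n₁ s) (n₂ s))
    _ = (d ! * 4 ^ d + ((d : ℝ) / 2 - 1)⁻¹) * ‖x‖ ^ (-((d : ℝ) - 2)) := by
        rw [integral_add' i₁ i₂, e₁, e₂, hRM, hRx]
        ring

end HeatKernel

theorem stmt9 (d : ℕ) (hd : 3 ≤ d) (γ : ℝ) (hγ : 2 < γ) (hγd : γ < d) :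
    ∃ C > 0, ∀ y : EuclideanSpace ℝ (Fin d), y ≠ 0 →
      fGamma d γ y ≤ C * ‖y‖ ^ (-(γ - 2)) := by
  have hd' : (3 : ℝ) ≤ d := by exact_mod_cast hd
  have hfr : Module.finrank ℝ (EuclideanSpace ℝ (Fin d)) = d := by simp
  have : Nontrivial (EuclideanSpace ℝ (Fin d)) :=
    Module.nontrivial_of_finrank_pos (R := ℝ) (by rw [hfr]; lia)
  obtain ⟨K, hK, hfK⟩ := exists_fOcc_le_norm_rpow hd
  obtain ⟨c, hc, hconv⟩ := exists_integrable_norm_rpow_convolution_le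
    (volume : Measure (EuclideanSpace ℝ (Fin d))) (a := (d : ℝ) - 2) (b := γ)
    (by linarith) (by linarith) (by rw [hfr]; linarith) (by rwa [hfr]) (by rw [hfr]; linarith)
  refine ⟨K * c + 1, by positivity, fun y hy ↦ ?_⟩
  obtain ⟨g, hg, hle, hint⟩ := hconv y hy
  rw [hfr, show (d : ℝ) - (d - 2 + γ) = -(γ - 2) by ring] at hint
  calc fGamma d γ y ≤ ∫ x, K * g x := by
        refine integral_mono_of_nonneg (ae_of_all _ fun x ↦ ?_) (hg.const_mul K) ?_
        · exact mul_nonneg (fOcc_nonneg _) (by positivity)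
        · filter_upwards [Measure.ae_ne volume y] with x hx
          calc fOcc d (y - x) * ‖x‖ ^ (-γ)
              ≤ K * ‖y - x‖ ^ (-((d : ℝ) - 2)) * ‖x‖ ^ (-γ) := by
                gcongr
                exact hfK _ (sub_ne_zero.2 hx.symm)
            _ ≤ K * g x := by
                rw [mul_assoc]
                exact mul_le_mul_of_nonneg_left (hle x) hK.le
    _ = K * c * ‖y‖ ^ (-(γ - 2)) := by rw [integral_const_mul, hint, mul_assoc]
    _ ≤ (K * c + 1) * ‖y‖ ^ (-(γ - 2)) := by
        gcongr
        linarith
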